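/- Let P ∈ GL_n(K) and let s, t be integers with 0 ≤ t ≤ s ≤ n such that for every i ∈ {1,…,m} the matrix P (a_i ∧ b_i) Pᵀ has a zero entry in position (p, q) whenever p > n − s and q > n − t. Then there exists a nested 2-cover (S, T) for the lines ℓ_1,…,ℓ_m with dim S + dim T = 2n − s − t (namely dim S = n − s and dim T = n − t). -/

import Mathlib

open Matrix

noncomputable section

/-- Wedge product `a ∧ b = a bᵀ − b aᵀ`. -/
def wedge {K : Type*} [Field K] {n : ℕ} (a b : Fin n → K) : Matrix (Fin n) (Fin n) K :=
  vecMulVec a b - vecMulVec b a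

/-- The line spanned by `a` and `b`. -/
def line {K : Type*} [Field K] {n : ℕ} (a b : Fin n → K) : Submodule K (Fin n → K) :=
  Submodule.span K {a, b}

/-- The preimage under `P` of the space of vectors supported on the first `k` coordinates. -/
def coordPreimage {K : Type*} [Field K] {n : ℕ} (P : Matrix (Fin n) (Fin n) K) (k : ℕ) :
    Submodule K (Fin n → K) :=
  (⨅ p ∈ {p : Fin n | k ≤ (p : ℕ)}, LinearMap.ker (LinearMap.proj p)).comap P.mulVecLin

theorem mem_coordPreimage {K : Type*} [Field K] {n : ℕ} {P : Matrix (Fin n) (Fin n) K} {k : ℕ}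
    {x : Fin n → K} : x ∈ coordPreimage P k ↔ ∀ p : Fin n, k ≤ (p : ℕ) → (P *ᵥ x) p = 0 := by
  simp [coordPreimage, Submodule.mem_iInf]

theorem coordPreimage_mono {K : Type*} [Field K] {n : ℕ} (P : Matrix (Fin n) (Fin n) K) :
    Monotone (coordPreimage P) := fun _ _ hkl _ hx =>
  mem_coordPreimage.2 fun p hp => mem_coordPreimage.1 hx p (hkl.trans hp)

theorem finrank_coordPreimage {K : Type*} [Field K] {n : ℕ} {P : Matrix (Fin n) (Fin n) K}
    (hP : IsUnit P) {k : ℕ} (hk : k ≤ n) : Module.finrank K (coordPreimage P k) = k := by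
  have hbij : Function.Bijective P.mulVecLin :=
    ⟨Matrix.mulVec_injective_iff_isUnit.2 hP, Matrix.mulVec_surjective_iff_isUnit.2 hP⟩
  let e := LinearEquiv.ofBijective P.mulVecLin hbij
  have hcomap (W : Submodule K (Fin n → K)) :
      W.comap P.mulVecLin = W.map (e.symm : (Fin n → K) →ₗ[K] Fin n → K) :=
    W.comap_equiv_eq_map_symm e
  rw [coordPreimage, hcomap, LinearEquiv.finrank_map_eq,
    (LinearMap.iInfKerProjEquiv K (fun _ : Fin n => K)
      (I := {p : Fin n | (p : ℕ) < k}) (J := {p : Fin n | k ≤ (p : ℕ)})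
      (Set.disjoint_left.2 fun p (hp : (p : ℕ) < k) (hq : k ≤ (p : ℕ)) => hp.not_ge hq)
      (fun p _ => lt_or_ge (p : ℕ) k)).finrank_eq,
    Module.finrank_fintype_fun_eq_card]
  simp [Fintype.card_subtype, Fin.card_filter_val_lt, hk]

theorem mul_wedge_mul_transpose {K : Type*} [Field K] {n : ℕ} (P : Matrix (Fin n) (Fin n) K)
    (a b : Fin n → K) : P * wedge a b * Pᵀ = wedge (P *ᵥ a) (P *ᵥ b) := by
  simp [wedge, Matrix.mul_sub, Matrix.sub_mul, Matrix.mul_vecMulVec, Matrix.vecMulVec_mul,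
    Matrix.vecMul_transpose]

theorem finrank_line {K : Type*} [Field K] {n : ℕ} {a b : Fin n → K}
    (hab : LinearIndependent K ![a, b]) : Module.finrank K (line a b) = 2 := by
  rw [line, ← Matrix.range_cons_cons_empty a b ![], finrank_span_eq_card hab, Fintype.card_fin]

/-- If `P ∈ GL_n(K)` and `0 ≤ t ≤ s ≤ n` are such that each `P (aᵢ ∧ bᵢ) Pᵀ` has zero
entries in all positions `(p, q)` with `p > n − s` and `q > n − t`, then there is a nested
2-cover `(S, T)` with `dim S = n − s` and `dim T = n − t` (so `dim S + dim T = 2n − s − t`). -/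
theorem nested_two_cover_of_zero_block
    {K : Type*} [Field K] {n m : ℕ} (hn : 0 < n) (hm : 0 < m)
    (a b : Fin m → Fin n → K) (hab : ∀ i, LinearIndependent K ![a i, b i])
    (P : Matrix (Fin n) (Fin n) K) (hP : IsUnit P)
    (s t : ℕ) (hts : t ≤ s) (hsn : s ≤ n)
    (hzero : ∀ i : Fin m, ∀ p q : Fin n, n - s ≤ (p : ℕ) → n - t ≤ (q : ℕ) →
      (P * wedge (a i) (b i) * Pᵀ) p q = 0) :
    ∃ S T : Submodule K (Fin n → K), S ≤ T ∧
      (∀ i, 2 ≤ Module.finrank K ↥(S ⊓ line (a i) (b i)) +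
        Module.finrank K ↥(T ⊓ line (a i) (b i))) ∧
      Module.finrank K ↥S = n - s ∧ Module.finrank K ↥T = n - t := by
  refine ⟨coordPreimage P (n - s), coordPreimage P (n - t),
    coordPreimage_mono P (by omega), fun i => ?_,
    finrank_coordPreimage hP (by omega), finrank_coordPreimage hP (by omega)⟩
  have hST := coordPreimage_mono P (show n - s ≤ n - t by omega)
  have hz : ∀ p q : Fin n, n - s ≤ (p : ℕ) → n - t ≤ (q : ℕ) →
      (P *ᵥ a i) p * (P *ᵥ b i) q - (P *ᵥ b i) p * (P *ᵥ a i) q = 0 := by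
    intro p q hp hq
    have h := hzero i p q hp hq
    rwa [mul_wedge_mul_transpose] at h
  by_cases hT : line (a i) (b i) ≤ coordPreimage P (n - t)
  · rw [inf_eq_right.2 hT, finrank_line (hab i)]
    omega
  obtain ⟨q, hq, hne⟩ : ∃ q : Fin n, n - t ≤ (q : ℕ) ∧
      ¬ ((P *ᵥ b i) q = 0 ∧ (P *ᵥ a i) q = 0) := by
    by_contra! h
    refine hT (Submodule.span_le.2 ?_)
    rintro x (rfl | rfl)
    · exact mem_coordPreimage.2 fun q hq => (h q hq).2
    · exact mem_coordPreimage.2 fun q hq => (h q hq).1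
  let w := (P *ᵥ b i) q • a i + (-(P *ᵥ a i) q) • b i
  have hw0 : w ≠ 0 := fun h => by
    have := LinearIndependent.pair_iff.1 (hab i) _ _ h
    exact hne ⟨this.1, neg_eq_zero.1 this.2⟩
  have hwS : w ∈ coordPreimage P (n - s) := mem_coordPreimage.2 fun p hp => by
    simp only [w, mulVec_add, mulVec_smul, Pi.add_apply, Pi.smul_apply, smul_eq_mul]
    linear_combination hz p q hp hq
  have hwl : w ∈ line (a i) (b i) := Submodule.mem_span_pair.2 ⟨_, _, rfl⟩
  have hS : 1 ≤ Module.finrank K ↥(coordPreimage P (n - s) ⊓ line (a i) (b i)) :=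
    Submodule.one_le_finrank_iff.2 ((Submodule.ne_bot_iff _).2 ⟨w, ⟨hwS, hwl⟩, hw0⟩)
  have := Submodule.finrank_mono (inf_le_inf_right (line (a i) (b i)) hST)
  omega
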